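/- Let p be a positive integer and let (Ω, 𝓕, ℙ) be a probability space. For each N, let Z_N and F_N be random real N×p matrices and d_N a random vector in ℝ^N on Ω, and define the instrumental-variables estimate Δφ̂_N(ω) = -((Z_N(ω)ᵀ F_N(ω))⁻¹) Z_N(ω)ᵀ d_N(ω). Suppose that almost surely (1/N) Z_Nᵀ F_N → M(ω) as N → ∞ where M(ω) is an invertible p×p matrix, and that almost surely (1/N) Z_Nᵀ d_N → 0. Then almost surely Δφ̂_N → 0 as N → ∞; that is, the instrumental-variables estimate converges to the true parameter with probability 1. -/

import Mathlib

open Matrix Filter Topology MeasureTheory ProbabilityTheory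

/-- Inversion of square matrices over a topological field is continuous at units. -/
theorem tendsto_matrix_inv {α n K : Type*} [Fintype n] [DecidableEq n] [Field K]
    [TopologicalSpace K] [IsTopologicalRing K] [ContinuousInv₀ K] {l : Filter α}
    {A : α → Matrix n n K} {M : Matrix n n K} (hM : IsUnit M) (hA : Tendsto A l (𝓝 M)) :
    Tendsto (fun a => (A a)⁻¹) l (𝓝 M⁻¹) := by
  have hdet : M.det ≠ 0 := ((Matrix.isUnit_iff_isUnit_det M).1 hM).ne_zero
  simp only [Matrix.inv_def, Ring.inverse_eq_inv']
  exact (((continuous_id.matrix_det.tendsto M).comp hA).inv₀ hdet).smul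
    ((continuous_id.matrix_adjugate.tendsto M).comp hA)

/-- Rescaling both the matrix and the right-hand side of a linear system by the same nonzero
scalar leaves `A⁻¹ *ᵥ b` unchanged, also for singular `A`. -/
theorem inv_smul_mulVec_smul {n K : Type*} [Fintype n] [DecidableEq n] [Field K]
    {c : K} (hc : c ≠ 0) (A : Matrix n n K) (b : n → K) :
    (c • A)⁻¹ *ᵥ (c • b) = A⁻¹ *ᵥ b := by
  by_cases hA : IsUnit A.det
  · rw [show c • A = Units.mk0 c hc • A from rfl, Matrix.inv_smul' A (Units.mk0 c hc) hA,
      Matrix.mulVec_smul, Units.smul_def, Matrix.smul_mulVec, smul_smul]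
    simp [hc]
  · have hcA : ¬ IsUnit (c • A).det := by
      simpa [Matrix.det_smul, hc] using hA
    rw [Matrix.nonsing_inv_apply_not_isUnit _ hA, Matrix.nonsing_inv_apply_not_isUnit _ hcA,
      Matrix.zero_mulVec, Matrix.zero_mulVec]

/-- **Theorem 4, probabilistic form.** If almost surely
`(1/N) Z_Nᵀ F_N → M(ω)` with `M(ω)` invertible and almost surely
`(1/N) Z_Nᵀ d_N → 0`, then almost surely the instrumental-variables estimate
`Δφ̂_N = -(Z_Nᵀ F_N)⁻¹ Z_Nᵀ d_N` converges to `0`: the estimate converges to the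
true parameter with probability 1. -/
theorem iv_consistent_as (p : ℕ) (hp : 0 < p)
    (Ω : Type*) [MeasureSpace Ω] [IsProbabilityMeasure (ℙ : Measure Ω)]
    (Z F : ∀ N : ℕ, Ω → Matrix (Fin N) (Fin p) ℝ) (d : ∀ N : ℕ, Ω → Fin N → ℝ)
    (M : Ω → Matrix (Fin p) (Fin p) ℝ)
    (hZF : ∀ᵐ ω ∂(ℙ : Measure Ω), IsUnit (M ω) ∧
        Tendsto (fun N : ℕ => (N : ℝ)⁻¹ • ((Z N ω)ᵀ * F N ω)) atTop (𝓝 (M ω)))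
    (hZd : ∀ᵐ ω ∂(ℙ : Measure Ω),
        Tendsto (fun N : ℕ => (N : ℝ)⁻¹ • (Z N ω)ᵀ.mulVec (d N ω)) atTop (𝓝 0)) :
    ∀ᵐ ω ∂(ℙ : Measure Ω),
      Tendsto (fun N : ℕ => -(((Z N ω)ᵀ * F N ω)⁻¹.mulVec ((Z N ω)ᵀ.mulVec (d N ω))))
        atTop (𝓝 0) := by
  filter_upwards [hZF, hZd] with ω ⟨hM, hA⟩ hb
  have hlim := (((continuous_fst.matrix_mulVec continuous_snd).tendsto ((M ω)⁻¹, (0 : Fin p → ℝ))).comp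
    ((tendsto_matrix_inv hM hA).prodMk_nhds hb)).neg
  simp only [Matrix.mulVec_zero, neg_zero] at hlim
  refine hlim.congr' ?_
  filter_upwards [eventually_ne_atTop 0] with N hN
  exact congrArg Neg.neg
    (inv_smul_mulVec_smul (inv_ne_zero (Nat.cast_ne_zero.2 hN)) _ _)
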